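/- For every prime $p \geq 5$, any collection of affine lines in $\mathbb{F}_p^2$, none of which passes through the origin, whose union covers the set $S_{p+1,2} \setminus \{(0,0)\}$, must contain at least $p+1$ lines. Here $S_{p+1,2} = \{(z_1, z_2) \in [0,p-1]^2 : z_1 + z_2 \leq p\}$ (sum in $\mathbb{Z}$), identified with a subset of $\mathbb{F}_p^2$. -/

import Mathlib

theorem eq_zero_of_diff_eq_zero {R : Type*} [CommRing R] {f : ℕ → ℕ → R} (h0 : f 0 0 = 0)
    (hx : ∀ x y, f (x + 1) y - f x y = 0) (hy : ∀ x y, f x (y + 1) - f x y = 0) (x y : ℕ) :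
    f x y = 0 := by
  induction x with
  | zero =>
    induction y with
    | zero => exact h0
    | succ y ih => rw [sub_eq_zero.1 (hy 0 y), ih]
  | succ x ih => rw [sub_eq_zero.1 (hx x y), ih]

/-- `f : ℕ → ℕ → R` behaves like a polynomial of total degree less than `n`: all its mixed forward
differences of order `n` vanish. -/
def DegLT {R : Type*} [CommRing R] : ℕ → (ℕ → ℕ → R) → Prop
  | 0, f => ∀ x y, f x y = 0
  | n + 1, f => DegLT n (fun x y => f (x + 1) y - f x y) ∧ DegLT n (fun x y => f x (y + 1) - f x y)

namespace DegLT

variable {R : Type*} [CommRing R]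

theorem zero (n : ℕ) : DegLT n (fun _ _ => (0 : R)) := by
  induction n with
  | zero => intro x y; rfl
  | succ n ih => constructor <;> simpa using ih

theorem succ {n : ℕ} {f : ℕ → ℕ → R} (hf : DegLT n f) : DegLT (n + 1) f := by
  induction n generalizing f with
  | zero => exact ⟨fun x y => by simp [hf _ _], fun x y => by simp [hf _ _]⟩
  | succ n ih => exact ⟨ih hf.1, ih hf.2⟩

theorem mono {m n : ℕ} (hmn : m ≤ n) {f : ℕ → ℕ → R} (hf : DegLT m f) : DegLT n f := by
  induction hmn with
  | refl => exact hf
  | step _ ih => exact ih.succ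

theorem add {n : ℕ} {f g : ℕ → ℕ → R} (hf : DegLT n f) (hg : DegLT n g) :
    DegLT n (fun x y => f x y + g x y) := by
  induction n generalizing f g with
  | zero => intro x y; simp [hf x y, hg x y]
  | succ n ih =>
    refine ⟨?_, ?_⟩
    · convert ih hf.1 hg.1 using 3; ring
    · convert ih hf.2 hg.2 using 3; ring

theorem const_mul {n : ℕ} {f : ℕ → ℕ → R} (hf : DegLT n f) (c : R) :
    DegLT n (fun x y => c * f x y) := by
  induction n generalizing f with
  | zero => intro x y; simp [hf x y]
  | succ n ih =>
    refine ⟨?_, ?_⟩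
    · convert ih hf.1 using 3; ring
    · convert ih hf.2 using 3; ring

theorem sub {n : ℕ} {f g : ℕ → ℕ → R} (hf : DegLT n f) (hg : DegLT n g) :
    DegLT n (fun x y => f x y - g x y) := by
  convert hf.add (hg.const_mul (-1)) using 3; ring

theorem linear_mul {n : ℕ} {f : ℕ → ℕ → R} (hf : DegLT n f) (a b c : R) :
    DegLT (n + 1) (fun x y => (a * x + b * y + c) * f x y) := by
  induction n generalizing f c with
  | zero => constructor <;> intro x y <;> simp [hf _ _]
  | succ n ih =>
    refine ⟨?_, ?_⟩
    · convert (ih hf.1 (c + a)).add (hf.const_mul a) using 3; push_cast; ring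
    · convert (ih hf.2 (c + b)).add (hf.const_mul b) using 3; push_cast; ring

theorem one : DegLT 1 (fun _ _ => (1 : R)) := by
  constructor <;> intro x y <;> simp

theorem prod_linear {ι : Type*} (s : Finset ι) (a b c : ι → R) :
    DegLT (s.card + 1) (fun x y => ∏ i ∈ s, (a i * x + b i * y + c i)) := by
  classical
  induction s using Finset.induction_on with
  | empty => simpa using one
  | insert i s hi ih =>
    simpa [Finset.prod_insert hi, Finset.card_insert_of_notMem hi] using
      ih.linear_mul (a i) (b i) (c i)

theorem choose_add (n k : ℕ) : DegLT (n + 1) (fun x y => ((x + y + k).choose n : R)) := by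
  induction n with
  | zero => simpa using one
  | succ n ih =>
    refine ⟨?_, ?_⟩
    · convert ih using 3 with x y
      beta_reduce
      rw [show x + 1 + y + k = (x + y + k) + 1 by ring, Nat.choose_succ_succ]; push_cast; ring
    · convert ih using 3 with x y
      beta_reduce
      rw [show x + (y + 1) + k = (x + y + k) + 1 by ring, Nat.choose_succ_succ]; push_cast; ring

theorem choose_left (n : ℕ) : DegLT (n + 1) (fun x _ => (x.choose n : R)) := by
  induction n with
  | zero => simpa using one
  | succ n ih =>
    refine ⟨?_, by simpa using zero _⟩
    convert ih using 3 with x y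
    beta_reduce
    rw [Nat.choose_succ_succ]; push_cast; ring

theorem choose_right (n : ℕ) : DegLT (n + 1) (fun _ y => (y.choose n : R)) := by
  induction n with
  | zero => simpa using one
  | succ n ih =>
    refine ⟨by simpa using zero _, ?_⟩
    convert ih using 3 with x y
    beta_reduce
    rw [Nat.choose_succ_succ]; push_cast; ring

/-- A function of degree at most `n` vanishing on the triangle `x + y ≤ n` vanishes identically. -/
theorem eq_zero_of_triangle {n : ℕ} {f : ℕ → ℕ → R} (hf : DegLT (n + 1) f)
    (h : ∀ x y, x + y ≤ n → f x y = 0) (x y : ℕ) : f x y = 0 := by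
  induction n generalizing f x y with
  | zero => exact eq_zero_of_diff_eq_zero (h 0 0 le_rfl) hf.1 hf.2 x y
  | succ n ih =>
    refine eq_zero_of_diff_eq_zero (h 0 0 (Nat.zero_le _))
      (ih hf.1 fun x y hxy => ?_) (ih hf.2 fun x y hxy => ?_) x y
    · rw [h (x + 1) y (by lia), h x y (by lia), sub_zero]
    · rw [h x (y + 1) (by lia), h x y (by lia), sub_zero]

end DegLT

/-- Modulo a prime `p`, the binomial coefficient `M.choose p` is `M / p`. -/
theorem natCast_choose_prime (p : ℕ) [Fact p.Prime] (M : ℕ) :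
    (M.choose p : ZMod p) = ((M / p : ℕ) : ZMod p) := by
  have hp := (Fact.out : p.Prime).pos
  have h := Choose.choose_modEq_choose_mod_mul_choose_div_nat (n := M) (k := p) (p := p)
  rw [← ZMod.natCast_eq_natCast_iff] at h
  simpa [Nat.div_self hp] using h

/-- A function of degree at most `p` on `𝔽_p²` which vanishes at the non-zero points of the triangle
`x + y ≤ p` takes the value `-f 0 0` outside this triangle. -/
theorem DegLT.apply_of_prime_lt_add {p : ℕ} [Fact p.Prime] {f : ℕ → ℕ → ZMod p}
    (hf : DegLT (p + 1) f) (hx : f p 0 = f 0 0) (hy : f 0 p = f 0 0)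
    (h : ∀ x y, x < p → y < p → x + y ≤ p → (x, y) ≠ (0, 0) → f x y = 0)
    {x y : ℕ} (hxp : x < p) (hyp : y < p) (hxy : p < x + y) : f x y = -f 0 0 := by
  have hp := (Fact.out : p.Prime).pos
  have div_of_lt {M : ℕ} (hM : M < p) : M / p = 0 := Nat.div_eq_of_lt hM
  have div_one {M : ℕ} (h1 : p ≤ M) (h2 : M < 2 * p) : M / p = 1 :=
    Nat.div_eq_of_lt_le (by lia) (by lia)
  have div_two {M : ℕ} (h1 : 2 * p ≤ M) (h2 : M < 3 * p) : M / p = 2 :=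
    Nat.div_eq_of_lt_le (by lia) (by lia)
  have hE : DegLT (p + 1) (fun x y : ℕ => f x y - f 0 0 *
      (1 - ((x + y + (p - 1)).choose p : ZMod p) + (x.choose p : ZMod p) + y.choose p)) :=
    hf.sub (DegLT.const_mul ((((DegLT.one.mono (by lia)).sub (DegLT.choose_add p (p - 1))).add
      (DegLT.choose_left p)).add (DegLT.choose_right p)) _)
  have key := hE.eq_zero_of_triangle (fun x y hxy => by
    simp only [natCast_choose_prime]
    rcases Nat.eq_zero_or_pos (x + y) with h0 | h0
    · obtain ⟨rfl, rfl⟩ : x = 0 ∧ y = 0 := by lia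
      rw [div_of_lt (M := 0 + 0 + (p - 1)) (by lia)]
      simp
    rw [div_one (M := x + y + (p - 1)) (by lia) (by lia)]
    rcases eq_or_ne x p with rfl | hx'
    · obtain rfl : y = 0 := by lia
      simp [Nat.div_self hp, hx]
    rcases eq_or_ne y p with rfl | hy'
    · obtain rfl : x = 0 := by lia
      simp [Nat.div_self hp, hy]
    rw [div_of_lt (M := x) (by lia), div_of_lt (M := y) (by lia),
      h x y (by lia) (by lia) hxy (by simp only [ne_eq, Prod.mk.injEq]; lia)]
    simp) x y
  simp only [natCast_choose_prime] at key
  rw [div_of_lt hxp, div_of_lt hyp, div_two (by lia) (by lia)] at key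
  push_cast at key
  linear_combination key

/-- A line of the plane is cut out by one affine equation. -/
theorem exists_equation_of_finrank_direction_eq_one {K : Type*} [Field K]
    (H : AffineSubspace K (K × K)) (h1 : Module.finrank K H.direction = 1)
    (hne : (H : Set (K × K)).Nonempty) :
    ∃ a b c : K, ∀ x y : K, (x, y) ∈ H ↔ a * x + b * y + c = 0 := by
  obtain ⟨q, hq⟩ := hne
  obtain ⟨⟨v, hv⟩, hv0, hspan⟩ := finrank_eq_one_iff'.1 h1
  refine ⟨-v.2, v.1, v.2 * q.1 - v.1 * q.2, fun x y => ?_⟩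
  rw [← AffineSubspace.vsub_right_mem_direction_iff_mem hq]
  constructor
  · intro hw
    obtain ⟨k, hk⟩ := hspan ⟨_, hw⟩
    have hk' : k • v = (x, y) - q := congrArg Subtype.val hk
    have e1 := congrArg Prod.fst hk'
    have e2 := congrArg Prod.snd hk'
    simp only [Prod.smul_fst, Prod.smul_snd, smul_eq_mul, Prod.fst_sub, Prod.snd_sub] at e1 e2
    linear_combination v.2 * e1 - v.1 * e2
  · intro he
    have hv0' : v.1 ≠ 0 ∨ v.2 ≠ 0 := by
      by_contra! hc
      exact hv0 (Subtype.ext (Prod.ext hc.1 hc.2))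
    rcases hv0' with hv1 | hv2
    · convert H.direction.smul_mem ((x - q.1) / v.1) hv using 1
      ext
      · simp [hv1]
      · simp only [vsub_eq_sub, Prod.snd_sub, Prod.smul_snd, smul_eq_mul]
        field_simp
        linear_combination he
    · convert H.direction.smul_mem ((y - q.2) / v.2) hv using 1
      ext
      · simp only [vsub_eq_sub, Prod.fst_sub, Prod.smul_fst, smul_eq_mul]
        field_simp
        linear_combination -he
      · simp [hv2]

/-- Every line of `𝔽_p²` given by `x = 2 + t * y` leaves the triangle `x + y ≤ p`. -/
theorem exists_prime_lt_add_on_line {p : ℕ} [Fact p.Prime] (hp5 : 5 ≤ p) (t : ZMod p) :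
    ∃ x y : ℕ, x < p ∧ y < p ∧ p < x + y ∧ (x : ZMod p) = 2 + t * y := by
  have cast_sub {k : ℕ} (hk : k ≤ p) : ((p - k : ℕ) : ZMod p) = -k := by
    rw [Nat.cast_sub hk]; simp
  by_cases h : 2 ≤ (2 - t).val
  · refine ⟨(2 - t).val, p - 1, ZMod.val_lt _, by lia, by lia, ?_⟩
    rw [cast_sub (by lia), ZMod.natCast_zmod_val]
    push_cast; ring
  · have h2 : (((2 - t).val : ℕ) : ZMod p) = 2 - t := ZMod.natCast_zmod_val _
    obtain h0 | h0 : (2 - t).val = 0 ∨ (2 - t).val = 1 := by lia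
    · refine ⟨p - 2, p - 2, by lia, by lia, by lia, ?_⟩
      rw [cast_sub (by lia)]
      rw [h0] at h2
      push_cast at h2 ⊢
      linear_combination 2 * h2
    · refine ⟨p - 1, p - 3, by lia, by lia, by lia, ?_⟩
      rw [cast_sub (by lia), cast_sub (by lia)]
      rw [h0] at h2
      push_cast at h2 ⊢
      linear_combination 3 * h2

theorem stmt_5 (p : ℕ) [Fact p.Prime] (hp5 : 5 ≤ p)
    (L : Finset (AffineSubspace (ZMod p) (ZMod p × ZMod p)))
    (hline : ∀ H ∈ L, Module.finrank (ZMod p) H.direction = 1 ∧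
      ((H : Set (ZMod p × ZMod p)).Nonempty))
    (hzero : ∀ H ∈ L, ((0, 0) : ZMod p × ZMod p) ∉ H)
    (hcover : ∀ z : ZMod p × ZMod p, z.1.val + z.2.val ≤ p → z ≠ (0, 0) →
      ∃ H ∈ L, z ∈ H) :
    p + 1 ≤ L.card := by
  by_contra! hcard
  have heq : ∀ H : L, ∃ a b c : ZMod p, ∀ x y, (x, y) ∈ H.1 ↔ a * x + b * y + c = 0 :=
    fun H => exists_equation_of_finrank_direction_eq_one H.1 (hline H H.2).1 (hline H H.2).2
  choose a b c habc using heq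
  set f : ℕ → ℕ → ZMod p := fun x y => ∏ H ∈ L.attach, (a H * x + b H * y + c H) with hf
  have hdeg : DegLT (p + 1) f :=
    (DegLT.prod_linear L.attach a b c).mono (by rw [Finset.card_attach]; lia)
  have f_eq_zero {x y : ℕ} {H} (hH : H ∈ L) (hxy : ((x : ZMod p), (y : ZMod p)) ∈ H) :
      f x y = 0 :=
    Finset.prod_eq_zero (Finset.mem_attach L ⟨H, hH⟩) ((habc ⟨H, hH⟩ _ _).1 hxy)
  have hf0 : f 0 0 ≠ 0 := by
    refine Finset.prod_ne_zero_iff.2 fun H _ h0 => hzero H H.2 ((habc H 0 0).2 ?_)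
    simpa using h0
  have hcov : ∀ x y : ℕ, x < p → y < p → x + y ≤ p → (x, y) ≠ (0, 0) →
      ∃ H ∈ L, ((x : ZMod p), (y : ZMod p)) ∈ H := by
    intro x y hx hy hxy hne
    refine hcover _ (by simpa [ZMod.val_cast_of_lt hx, ZMod.val_cast_of_lt hy] using hxy) ?_
    contrapose! hne
    simp only [Prod.mk.injEq, ZMod.natCast_eq_zero_iff] at hne ⊢
    exact ⟨Nat.eq_zero_of_dvd_of_lt hne.1 hx, Nat.eq_zero_of_dvd_of_lt hne.2 hy⟩
  obtain ⟨H, hH, hmem⟩ := hcov 2 0 (by lia) (by lia) (by lia) (by simp)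
  have h2 := (habc ⟨H, hH⟩ _ _).1 hmem
  have hc : c ⟨H, hH⟩ ≠ 0 := fun h0 => hzero H hH ((habc ⟨H, hH⟩ 0 0).2 (by simpa using h0))
  have ha : a ⟨H, hH⟩ ≠ 0 := by
    rintro h0
    exact hc (by simpa [h0] using h2)
  obtain ⟨x, y, hx, hy, hxy, hl⟩ :=
    exists_prime_lt_add_on_line hp5 (-b ⟨H, hH⟩ / a ⟨H, hH⟩)
  have hout := hdeg.apply_of_prime_lt_add (by simp [hf]) (by simp [hf])
    (fun x y hx hy hxy hne => (hcov x y hx hy hxy hne).elim fun H hH => f_eq_zero hH.1 hH.2)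
    hx hy hxy
  refine hf0 (neg_eq_zero.1 (hout.symm.trans (f_eq_zero hH ((habc ⟨H, hH⟩ _ _).2 ?_))))
  rw [hl]
  field_simp
  push_cast at h2
  linear_combination h2
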